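/- arXiv:2109.09104 — 7 statements merged into one kernel-verified Lean document; each statement's English description precedes it below -/
import Mathlib

section
/- Let k ≥ 1 and let x ∈ Ω_{2k} with t := T(x). Set Δ_l := −min_{i odd} x_i and Δ_u := min_{i even} x_i. Then Δ_l ≤ 0 ≤ Δ_u and the fiber {y ∈ Ω_{2k} : T(y) = t} equals the closed segment {x + Δ·a : Δ ∈ [Δ_l, Δ_u]}; in particular, for Δ ∈ ℝ, the point x + Δ·a lies in Ω_{2k} if and only if Δ ∈ [Δ_l, Δ_u]. -/
/-- The alternating sign vector `a ∈ ℝ^{2k}` with `a_i = +1` for odd `i` (1-based),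
i.e. for 0-based indices `i` with `i % 2 = 0`, and `a_i = -1` for even `i` (1-based). -/
def altVec (k : ℕ) : Fin (2 * k) → ℝ := fun i => if i.1 % 2 = 0 then 1 else -1

/-- The consecutive-sum map `T : ℝ^{2k} → ℝ^{2k-1}`. -/
def consecSum (k : ℕ) (w : Fin (2 * k) → ℝ) : Fin (2 * k - 1) → ℝ :=
  fun j => w ⟨j.1, by have := j.isLt; omega⟩ + w ⟨j.1 + 1, by have := j.isLt; omega⟩

/-- `Δ_l := −min_{i odd} x_i` (odd in the 1-based sense, i.e. 0-based `i % 2 = 0`). -/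
noncomputable def deltaL (k : ℕ) (x : Fin (2 * k) → ℝ) : ℝ :=
  -sInf {r : ℝ | ∃ i : Fin (2 * k), i.1 % 2 = 0 ∧ x i = r}

/-- `Δ_u := min_{i even} x_i` (even in the 1-based sense, i.e. 0-based `i % 2 = 1`). -/
noncomputable def deltaU (k : ℕ) (x : Fin (2 * k) → ℝ) : ℝ :=
  sInf {r : ℝ | ∃ i : Fin (2 * k), i.1 % 2 = 1 ∧ x i = r}

/-- for `x` in the nonnegative orthant `Ω_{2k}` with `t := T(x)`,
`Δ_l ≤ 0 ≤ Δ_u`, the fiber `{y ∈ Ω_{2k} : T(y) = t}` is the closed segment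
`{x + Δ·a : Δ ∈ [Δ_l, Δ_u]}`, and `x + Δ·a ∈ Ω_{2k} ↔ Δ ∈ [Δ_l, Δ_u]`. -/
theorem statement1 (k : ℕ) (hk : 1 ≤ k) (x : Fin (2 * k) → ℝ) (hx : ∀ i, 0 ≤ x i) :
    deltaL k x ≤ 0 ∧ 0 ≤ deltaU k x ∧
    {y : Fin (2 * k) → ℝ | (∀ i, 0 ≤ y i) ∧ consecSum k y = consecSum k x} =
      {y : Fin (2 * k) → ℝ |
        ∃ Δ ∈ Set.Icc (deltaL k x) (deltaU k x), y = x + Δ • altVec k} ∧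
    ∀ Δ : ℝ, (∀ i, 0 ≤ (x + Δ • altVec k) i) ↔ Δ ∈ Set.Icc (deltaL k x) (deltaU k x) := by
  have bdd : ∀ p : ℕ, BddBelow {r : ℝ | ∃ i : Fin (2 * k), i.1 % 2 = p ∧ x i = r} := by
    intro p
    refine ⟨0, ?_⟩
    rintro r ⟨i, -, rfl⟩
    exact hx i
  have ne0 : {r : ℝ | ∃ i : Fin (2 * k), i.1 % 2 = 0 ∧ x i = r}.Nonempty :=
    ⟨x ⟨0, by omega⟩, ⟨0, by omega⟩, rfl, rfl⟩
  have ne1 : {r : ℝ | ∃ i : Fin (2 * k), i.1 % 2 = 1 ∧ x i = r}.Nonempty :=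
    ⟨x ⟨1, by omega⟩, ⟨1, by omega⟩, rfl, rfl⟩
  have key : ∀ Δ : ℝ, (∀ i, 0 ≤ (x + Δ • altVec k) i) ↔
      Δ ∈ Set.Icc (deltaL k x) (deltaU k x) := by
    intro Δ
    constructor
    · intro h
      constructor
      · unfold deltaL
        have : -Δ ≤ sInf {r : ℝ | ∃ i : Fin (2 * k), i.1 % 2 = 0 ∧ x i = r} := by
          apply le_csInf ne0
          rintro r ⟨i, hi, rfl⟩
          have := h i
          simp [altVec, hi] at this
          linarith
        linarith
      · unfold deltaU
        apply le_csInf ne1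
        rintro r ⟨i, hi, rfl⟩
        have := h i
        simp [altVec, hi] at this
        linarith
    · rintro ⟨h1, h2⟩ i
      unfold deltaL at h1
      unfold deltaU at h2
      rcases Nat.mod_two_eq_zero_or_one i.1 with hi | hi
      · have := csInf_le (bdd 0) ⟨i, hi, rfl⟩
        simp [altVec, hi]
        linarith
      · have := csInf_le (bdd 1) ⟨i, hi, rfl⟩
        simp [altVec, hi]
        linarith
  have h0 := (key 0).1 (by intro i; simpa using hx i)
  refine ⟨h0.1, h0.2, ?_, key⟩
  ext y
  simp only [Set.mem_setOf_eq]
  constructor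
  · rintro ⟨hy, hT⟩
    have hk0 : 0 < 2 * k := by omega
    have hyx : y = x + (y ⟨0, hk0⟩ - x ⟨0, hk0⟩) • altVec k := by
      have : ∀ n (hn : n < 2 * k),
          y ⟨n, hn⟩ = (x + (y ⟨0, hk0⟩ - x ⟨0, hk0⟩) • altVec k) ⟨n, hn⟩ := by
        intro n
        induction n with
        | zero => intro hn; simp [altVec]
        | succ n ih =>
          intro hn
          have e := ih (by omega)
          have t := congrFun hT ⟨n, by omega⟩
          simp only [consecSum] at t
          rcases Nat.mod_two_eq_zero_or_one n with hi | hi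
          · have hi' : (n + 1) % 2 = 1 := by omega
            simp [altVec, hi, hi'] at e ⊢
            linarith
          · have hi' : (n + 1) % 2 = 0 := by omega
            simp [altVec, hi, hi'] at e ⊢
            linarith
      funext i
      exact this i.1 i.2
    refine ⟨_, (key _).1 ?_, hyx⟩
    rw [← hyx]
    exact hy
  · rintro ⟨Δ, hΔ, rfl⟩
    refine ⟨(key Δ).2 hΔ, ?_⟩
    funext j
    rcases Nat.mod_two_eq_zero_or_one j.1 with hi | hi
    · have hi' : (j.1 + 1) % 2 = 1 := by omega
      simp [consecSum, altVec, hi, hi']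
      ring
    · have hi' : (j.1 + 1) % 2 = 0 := by omega
      simp [consecSum, altVec, hi, hi']
      ring
end

section
/- Fix k-cycle coordinates in {1,…,n}² and let W, W′ be n×n matrices with nonnegative real entries that agree on every entry outside the 2k cycle coordinates. Let w, w′ ∈ ℝ^{2k} be the vectors of entries of W and W′ read along the cycle coordinates in their given order. Then W and W′ have equal out-strengths and equal in-strengths (all row sums and all column sums agree) if and only if T(w) = T(w′), where T is the consecutive-sum map. -/
open Finset

/-- The `2k` cycle coordinates `(u₁,v₁),(u₁,v₂),(u₂,v₂),(u₂,v₃),…,(u_k,v_k),(u_k,v₁)`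
in this order (0-based index `j`: row `u_{j/2}`, column `v_{j/2}` if `j` even,
column `v_{j/2+1 (mod k)}` if `j` odd). -/
def cycleCoords {n k : ℕ} (hk : 0 < k) (u v : Fin k → Fin n) :
    Fin (2 * k) → Fin n × Fin n := fun j =>
  (u ⟨j.1 / 2, by have := j.isLt; omega⟩,
    if j.1 % 2 = 0 then v ⟨j.1 / 2, by have := j.isLt; omega⟩
    else v ⟨(j.1 / 2 + 1) % k, Nat.mod_lt _ hk⟩)

/-- if `W, W′ ≥ 0` agree outside the cycle coordinates, then they have
equal row sums and equal column sums iff the consecutive sums of their cycle-weight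
vectors agree: `T(w) = T(w′)`. -/
theorem statement3 (n k : ℕ) (hk : 2 ≤ k) (hk0 : 0 < k) (u v : Fin k → Fin n)
    (hu : Function.Injective u) (hv : Function.Injective v)
    (W W' : Matrix (Fin n) (Fin n) ℝ)
    (hW : ∀ a b, 0 ≤ W a b) (hW' : ∀ a b, 0 ≤ W' a b)
    (hagree : ∀ p : Fin n × Fin n, p ∉ Set.range (cycleCoords hk0 u v) →
      W p.1 p.2 = W' p.1 p.2) :
    ((∀ a : Fin n, ∑ b, W a b = ∑ b, W' a b) ∧
      (∀ b : Fin n, ∑ a, W a b = ∑ a, W' a b)) ↔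
    consecSum k (fun j => W (cycleCoords hk0 u v j).1 (cycleCoords hk0 u v j).2) =
      consecSum k (fun j => W' (cycleCoords hk0 u v j).1 (cycleCoords hk0 u v j).2) := by
  classical
  let s : Fin k → Fin k := fun i => ⟨(i.1 + 1) % k, Nat.mod_lt _ hk0⟩
  have sval : ∀ i : Fin k, (s i).1 = if i.1 + 1 = k then 0 else i.1 + 1 := by
    intro i
    have := i.isLt
    show (i.1 + 1) % k = _
    split_ifs with h
    · rw [h, Nat.mod_self]
    · exact Nat.mod_eq_of_lt (by omega)
  have sne : ∀ i, s i ≠ i := by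
    intro i h
    have h1 := congrArg Fin.val h
    rw [sval] at h1
    split_ifs at h1 <;> omega
  have sinj : Function.Injective s := by
    intro i j h
    have h1 := congrArg Fin.val h
    rw [sval, sval] at h1
    apply Fin.ext
    split_ifs at h1 <;> omega
  have ssurj : Function.Surjective s := Finite.surjective_of_injective sinj
  have ceven : ∀ i : Fin k, ∀ h, cycleCoords hk0 u v ⟨2 * i.1, h⟩ = (u i, v i) := by
    intro i h
    have h1 : 2 * i.1 / 2 = i.1 := by omega
    have h2 : 2 * i.1 % 2 = 0 := by omega
    simp only [cycleCoords, h1, h2, if_true]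
  have codd : ∀ i : Fin k, ∀ h, cycleCoords hk0 u v ⟨2 * i.1 + 1, h⟩ = (u i, v (s i)) := by
    intro i h
    have h1 : (2 * i.1 + 1) / 2 = i.1 := by omega
    have h2 : ¬ (2 * i.1 + 1) % 2 = 0 := by omega
    simp only [cycleCoords, h1, h2, if_false, s]
  obtain ⟨D, hD⟩ : ∃ D : Fin n → Fin n → ℝ, ∀ a b, D a b = W a b - W' a b :=
    ⟨fun a b => W a b - W' a b, fun _ _ => rfl⟩
  have hsupp : ∀ a b, D a b ≠ 0 → ∃ i, a = u i ∧ (b = v i ∨ b = v (s i)) := by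
    intro a b h
    by_contra hc
    apply h
    rw [hD, sub_eq_zero]
    apply hagree (a, b)
    rintro ⟨j, hj⟩
    apply hc
    have hjl := j.isLt
    refine ⟨⟨j.1 / 2, by omega⟩, (congrArg Prod.fst hj).symm, ?_⟩
    have h2 := congrArg Prod.snd hj
    simp only [cycleCoords] at h2
    split_ifs at h2 with h3
    · exact Or.inl h2.symm
    · exact Or.inr h2.symm
  have hrow : ∀ i, ∑ b, D (u i) b = D (u i) (v i) + D (u i) (v (s i)) := by
    intro i
    apply Fintype.sum_eq_add _ _ (fun h => sne i (hv h).symm)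
    rintro b ⟨h1, h2⟩
    by_contra h
    obtain ⟨j, hj, hb⟩ := hsupp _ _ h
    have := hu hj
    subst this
    tauto
  have hcol : ∀ i, ∑ a, D a (v (s i)) = D (u i) (v (s i)) + D (u (s i)) (v (s i)) := by
    intro i
    apply Fintype.sum_eq_add _ _ (fun h => sne i (hu h).symm)
    rintro a ⟨h1, h2⟩
    by_contra h
    obtain ⟨j, hj, hb⟩ := hsupp _ _ h
    rcases hb with hb | hb
    · have := hv hb
      subst this
      exact h2 hj
    · have := sinj (hv hb)
      subst this
      exact h1 hj
  have hL : ((∀ a : Fin n, ∑ b, W a b = ∑ b, W' a b) ∧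
      (∀ b : Fin n, ∑ a, W a b = ∑ a, W' a b)) ↔
      ((∀ i, D (u i) (v i) + D (u i) (v (s i)) = 0) ∧
        (∀ i, D (u i) (v (s i)) + D (u (s i)) (v (s i)) = 0)) := by
    have e1 : ∀ a, (∑ b, W a b = ∑ b, W' a b) ↔ ∑ b, D a b = 0 := by
      intro a
      simp only [hD, Finset.sum_sub_distrib, sub_eq_zero]
    have e2 : ∀ b, (∑ a, W a b = ∑ a, W' a b) ↔ ∑ a, D a b = 0 := by
      intro a
      simp only [hD, Finset.sum_sub_distrib, sub_eq_zero]
    simp only [e1, e2, ← hrow, ← hcol]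
    constructor
    · rintro ⟨h1, h2⟩
      exact ⟨fun i => h1 _, fun i => h2 _⟩
    · rintro ⟨h1, h2⟩
      constructor
      · intro a
        by_cases ha : ∃ i, a = u i
        · obtain ⟨i, rfl⟩ := ha
          exact h1 i
        · apply Finset.sum_eq_zero
          intro b _
          by_contra h
          obtain ⟨i, hi, _⟩ := hsupp _ _ h
          exact ha ⟨i, hi⟩
      · intro b
        by_cases hb : ∃ i, b = v i
        · obtain ⟨i, rfl⟩ := hb
          obtain ⟨j, rfl⟩ := ssurj i
          exact h2 j
        · apply Finset.sum_eq_zero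
          intro a _
          by_contra h
          obtain ⟨i, _, hi | hi⟩ := hsupp _ _ h
          · exact hb ⟨_, hi⟩
          · exact hb ⟨_, hi⟩
  have hsucc : ∀ i : Fin k, ∀ h : i.1 + 1 < k, s i = ⟨i.1 + 1, h⟩ := by
    intro i h
    apply Fin.ext
    rw [sval, if_neg (by omega)]
  have hR : consecSum k (fun j => W (cycleCoords hk0 u v j).1 (cycleCoords hk0 u v j).2) =
      consecSum k (fun j => W' (cycleCoords hk0 u v j).1 (cycleCoords hk0 u v j).2) ↔
      ((∀ i, D (u i) (v i) + D (u i) (v (s i)) = 0) ∧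
        (∀ i : Fin k, i.1 + 1 < k → D (u i) (v (s i)) + D (u (s i)) (v (s i)) = 0)) := by
    constructor
    · intro h
      constructor
      · intro i
        have hi := i.isLt
        have h1 := congrFun h ⟨2 * i.1, by omega⟩
        simp only [consecSum, ceven, codd] at h1
        rw [hD, hD]
        linarith
      · intro i hi
        have h1 := congrFun h ⟨2 * i.1 + 1, by omega⟩
        have h3 := ceven ⟨i.1 + 1, hi⟩ (by simp only; omega)
        have h4 : cycleCoords hk0 u v ⟨2 * i.1 + 1 + 1, by omega⟩ = (u (s i), v (s i)) := by
          rw [hsucc i hi]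
          exact h3
        simp only [consecSum, codd, h4] at h1
        rw [hD, hD]
        linarith
    · rintro ⟨h1, h2⟩
      funext ⟨j, hj⟩
      rcases Nat.even_or_odd' j with ⟨c, rfl | rfl⟩
      · have h3 := h1 ⟨c, by omega⟩
        have h5 := ceven ⟨c, by omega⟩ (by simp only; omega)
        have h6 := codd ⟨c, by omega⟩ (by simp only; omega)
        simp only at h5 h6
        simp only [consecSum, h5, h6]
        rw [hD, hD] at h3
        linarith
      · have hc : c + 1 < k := by omega
        have h3 := h2 ⟨c, by omega⟩ hc
        have h6 := codd ⟨c, by omega⟩ (by simp only; omega)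
        have h7 := ceven ⟨c + 1, hc⟩ (by simp only; omega)
        have h4 : cycleCoords hk0 u v ⟨2 * c + 1 + 1, by omega⟩ =
          (u (s ⟨c, by omega⟩), v (s ⟨c, by omega⟩)) := by
          rw [hsucc ⟨c, by omega⟩ hc]
          exact h7
        simp only at h6
        simp only [consecSum, h6, h4]
        rw [hD, hD] at h3
        linarith
  rw [hL, hR]
  constructor
  · rintro ⟨h1, h2⟩
    exact ⟨h1, fun i _ => h2 i⟩
  · rintro ⟨h1, h2⟩
    refine ⟨h1, ?_⟩
    have key : ∀ m : ℕ, ∀ hm : m < k, D (u ⟨m, hm⟩) (v ⟨m, hm⟩) = D (u ⟨0, hk0⟩) (v ⟨0, hk0⟩) := by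
      intro m
      induction m with
      | zero => intro _; rfl
      | succ m ih =>
        intro hm
        have a1 := ih (by omega)
        have a2 := h1 ⟨m, by omega⟩
        have a3 := h2 ⟨m, by omega⟩ hm
        rw [hsucc ⟨m, by omega⟩ hm] at a2 a3
        linarith
    intro i
    have a1 := h1 i
    have a2 := key i.1 i.isLt
    have a3 := key (s i).1 (s i).isLt
    simp only [Fin.eta] at a2 a3
    linarith
end

section
/- Let k ≥ 1 and let x, y ∈ Ω_{2k} satisfy T(x) = T(y). Then the set of odd indices at which x attains the minimum of its odd-indexed coordinates equals the set of odd indices at which y attains the minimum of its odd-indexed coordinates, and likewise the sets of even indices attaining the minimum over even-indexed coordinates coincide. -/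
/-- if `x, y ∈ Ω_{2k}` satisfy `T(x) = T(y)`, then the set of odd
(1-based, i.e. 0-based `i % 2 = 0`) indices at which `x` attains the minimum of its
odd-indexed coordinates equals the corresponding set for `y`, and likewise for the
even-indexed (0-based `i % 2 = 1`) coordinates. -/
theorem statement4 (k : ℕ) (hk : 1 ≤ k) (x y : Fin (2 * k) → ℝ)
    (hx : ∀ i, 0 ≤ x i) (hy : ∀ i, 0 ≤ y i)
    (hT : consecSum k x = consecSum k y) :
    {i : Fin (2 * k) | i.1 % 2 = 0 ∧ ∀ j : Fin (2 * k), j.1 % 2 = 0 → x i ≤ x j} =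
      {i : Fin (2 * k) | i.1 % 2 = 0 ∧ ∀ j : Fin (2 * k), j.1 % 2 = 0 → y i ≤ y j} ∧
    {i : Fin (2 * k) | i.1 % 2 = 1 ∧ ∀ j : Fin (2 * k), j.1 % 2 = 1 → x i ≤ x j} =
      {i : Fin (2 * k) | i.1 % 2 = 1 ∧ ∀ j : Fin (2 * k), j.1 % 2 = 1 → y i ≤ y j} := by
  have key : ∃ t : ℝ, ∀ n : ℕ, ∀ h : n < 2 * k,
      x ⟨n, h⟩ = y ⟨n, h⟩ + (if n % 2 = 0 then t else -t) := by
    refine ⟨x ⟨0, by omega⟩ - y ⟨0, by omega⟩, fun n => ?_⟩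
    induction n with
    | zero => intro h; simp
    | succ n ih =>
      intro h
      have h1 := ih (by omega)
      have h2 := congrFun hT ⟨n, by omega⟩
      simp only [consecSum] at h2
      rcases Nat.mod_two_eq_zero_or_one n with hn | hn
      · have hn' : (n + 1) % 2 = 1 := by omega
        simp only [hn, hn', if_true, one_ne_zero, if_false] at h1 ⊢
        linarith
      · have hn' : (n + 1) % 2 = 0 := by omega
        simp only [hn, hn', if_true, one_ne_zero, if_false] at h1 ⊢
        linarith
  obtain ⟨t, ht⟩ := key
  have he : ∀ i : Fin (2 * k), i.1 % 2 = 0 → x i = y i + t := by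
    intro i hi
    have := ht i.1 i.2
    simpa [hi] using this
  have ho : ∀ i : Fin (2 * k), i.1 % 2 = 1 → x i = y i + -t := by
    intro i hi
    have := ht i.1 i.2
    simpa [hi] using this
  constructor
  · ext i
    simp only [Set.mem_setOf_eq]
    refine and_congr_right fun hi => forall_congr' fun j => imp_congr_right fun hj => ?_
    rw [he i hi, he j hj, add_le_add_iff_right]
  · ext i
    simp only [Set.mem_setOf_eq]
    refine and_congr_right fun hi => forall_congr' fun j => imp_congr_right fun hj => ?_
    rw [ho i hi, ho j hj, add_le_add_iff_right]
end

section
/- Let W be an n×n matrix with nonnegative real entries and let (U₁, V₁) and (U₂, V₂) be pairs of subsets of {1,…,n} such that for each i ∈ {1,2}: ∑_{u∈U_i} s⁻_u(W) = ∑_{v∈V_i} s⁺_v(W) and ∑_{u∈U_i} ∑_{v∉V_i} W_{uv} = 0. Then the pair U′ := U₁ \ U₂ and V′ := V₁ \ V₂ satisfies ∑_{u∈U′} ∑_{v∉V′} W_{uv} = 0 = ∑_{u∉U′} ∑_{v∈V′} W_{uv}, and hence ∑_{u∈U′} s⁻_u(W) = ∑_{v∈V′} s⁺_v(W). -/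
open Finset

theorem bal_identity {n : ℕ} (W : Matrix (Fin n) (Fin n) ℝ) (U V : Finset (Fin n)) :
    ∑ u ∈ U, ∑ v, W u v + ∑ u ∈ Uᶜ, ∑ v ∈ V, W u v
      = ∑ v ∈ V, ∑ u, W u v + ∑ u ∈ U, ∑ v ∈ Vᶜ, W u v := by
  have h1 : ∑ u ∈ U, ∑ v, W u v = ∑ u ∈ U, ∑ v ∈ V, W u v + ∑ u ∈ U, ∑ v ∈ Vᶜ, W u v := by
    rw [← Finset.sum_add_distrib]
    exact Finset.sum_congr rfl fun u _ => (Finset.sum_add_sum_compl V _).symm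
  have h2 : ∑ v ∈ V, ∑ u, W u v = ∑ u ∈ U, ∑ v ∈ V, W u v + ∑ u ∈ Uᶜ, ∑ v ∈ V, W u v := by
    rw [Finset.sum_comm, Finset.sum_add_sum_compl]
  rw [h1, h2]; ring

theorem double_zero {n : ℕ} (W : Matrix (Fin n) (Fin n) ℝ) (hW : ∀ u v, 0 ≤ W u v)
    (U V : Finset (Fin n)) (h : ∑ u ∈ U, ∑ v ∈ V, W u v = 0) :
    ∀ u ∈ U, ∀ v ∈ V, W u v = 0 := by
  intro u hu v hv
  have h1 := (Finset.sum_eq_zero_iff_of_nonneg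
    (fun u _ => Finset.sum_nonneg fun v _ => hW u v)).1 h u hu
  exact (Finset.sum_eq_zero_iff_of_nonneg (fun v _ => hW u v)).1 h1 v hv

/-- if `W ≥ 0` and the pairs `(U₁,V₁)`, `(U₂,V₂)` each satisfy
`∑_{u∈U_i} s⁻_u(W) = ∑_{v∈V_i} s⁺_v(W)` and `∑_{u∈U_i} ∑_{v∉V_i} W_{uv} = 0`, then
`U′ := U₁ \ U₂`, `V′ := V₁ \ V₂` satisfy
`∑_{u∈U′} ∑_{v∉V′} W_{uv} = 0 = ∑_{u∉U′} ∑_{v∈V′} W_{uv}` and hence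
`∑_{u∈U′} s⁻_u(W) = ∑_{v∈V′} s⁺_v(W)`. -/
theorem statement8 (n : ℕ) (W : Matrix (Fin n) (Fin n) ℝ)
    (hW : ∀ u v, 0 ≤ W u v) (U₁ V₁ U₂ V₂ : Finset (Fin n))
    (hbal₁ : ∑ u ∈ U₁, ∑ v, W u v = ∑ v ∈ V₁, ∑ u, W u v)
    (hzero₁ : ∑ u ∈ U₁, ∑ v ∈ V₁ᶜ, W u v = 0)
    (hbal₂ : ∑ u ∈ U₂, ∑ v, W u v = ∑ v ∈ V₂, ∑ u, W u v)
    (hzero₂ : ∑ u ∈ U₂, ∑ v ∈ V₂ᶜ, W u v = 0) :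
    ∑ u ∈ U₁ \ U₂, ∑ v ∈ (V₁ \ V₂)ᶜ, W u v = 0 ∧
    ∑ u ∈ (U₁ \ U₂)ᶜ, ∑ v ∈ V₁ \ V₂, W u v = 0 ∧
    ∑ u ∈ U₁ \ U₂, ∑ v, W u v = ∑ v ∈ V₁ \ V₂, ∑ u, W u v := by
  have a₁ := double_zero W hW _ _ hzero₁
  have a₂ := double_zero W hW _ _ hzero₂
  have b₁ := double_zero W hW U₁ᶜ V₁ (by linarith [bal_identity W U₁ V₁])
  have b₂ := double_zero W hW U₂ᶜ V₂ (by linarith [bal_identity W U₂ V₂])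
  simp only [Finset.mem_compl] at a₁ a₂ b₁ b₂
  have c : ∑ u ∈ U₁ \ U₂, ∑ v ∈ (V₁ \ V₂)ᶜ, W u v = 0 := by
    refine Finset.sum_eq_zero fun u hu => Finset.sum_eq_zero fun v hv => ?_
    simp only [Finset.mem_compl, Finset.mem_sdiff] at hu hv
    by_cases h : v ∈ V₁
    · exact b₂ u hu.2 v (by tauto)
    · exact a₁ u hu.1 v h
  have d : ∑ u ∈ (U₁ \ U₂)ᶜ, ∑ v ∈ V₁ \ V₂, W u v = 0 := by
    refine Finset.sum_eq_zero fun u hu => Finset.sum_eq_zero fun v hv => ?_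
    simp only [Finset.mem_compl, Finset.mem_sdiff] at hu hv
    by_cases h : u ∈ U₁
    · exact a₂ u (by tauto) v hv.2
    · exact b₁ u h v hv.1
  exact ⟨c, d, by linarith [bal_identity W (U₁ \ U₂) (V₁ \ V₂)]⟩
end

section
/- Let W be an n×n matrix with nonnegative real entries with out-strengths s⁻ and in-strengths s⁺, and let (U_i, V_i)_{i∈I} be a finite collection of pairs of nonempty subsets of {1,…,n} such that {U_i}_{i∈I} is a partition of {1,…,n}, {V_i}_{i∈I} is a partition of {1,…,n}, and each pair satisfies ∑_{u∈U_i} s⁻_u = ∑_{v∈V_i} s⁺_v. If W_{uv} > 0 for some u ∈ U_i and v ∈ V_j with i ≠ j, then ∑_{u′∈U_i} ∑_{v′∉V_i} W_{u′v′} = ∑_{u′∉U_i} ∑_{v′∈V_i} W_{u′v′} > 0; in particular W has two disjoint nonempty sets of entries with equal positive sums. -/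
open Finset

/-- let `W ≥ 0` with strengths `s⁻, s⁺`, and let `(U_i, V_i)_{i∈I}` be a
finite collection of pairs of nonempty sets with `{U_i}` and `{V_i}` partitions of the
node set and `∑_{u∈U_i} s⁻_u = ∑_{v∈V_i} s⁺_v` for each `i`. If `W_{uv} > 0` for some
`u ∈ U_i`, `v ∈ V_j` with `i ≠ j`, then
`∑_{u′∈U_i} ∑_{v′∉V_i} W = ∑_{u′∉U_i} ∑_{v′∈V_i} W > 0`; in particular `W` has two
disjoint nonempty sets of entries with equal positive sums. -/
theorem statement10 (n : ℕ) (W : Matrix (Fin n) (Fin n) ℝ)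
    (hW : ∀ u v, 0 ≤ W u v)
    (I : Type) [Fintype I] (U V : I → Finset (Fin n))
    (hUne : ∀ i, (U i).Nonempty) (hVne : ∀ i, (V i).Nonempty)
    (hUpart : ∀ u : Fin n, ∃! i, u ∈ U i)
    (hVpart : ∀ v : Fin n, ∃! i, v ∈ V i)
    (hbal : ∀ i, ∑ u ∈ U i, ∑ v, W u v = ∑ v ∈ V i, ∑ u, W u v)
    (i j : I) (hij : i ≠ j) (u v : Fin n) (hu : u ∈ U i) (hv : v ∈ V j)
    (hpos : 0 < W u v) :
    (∑ u' ∈ U i, ∑ v' ∈ (V i)ᶜ, W u' v' = ∑ u' ∈ (U i)ᶜ, ∑ v' ∈ V i, W u' v') ∧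
    (0 < ∑ u' ∈ U i, ∑ v' ∈ (V i)ᶜ, W u' v') ∧
    ∃ S₁ S₂ : Finset (Fin n × Fin n), S₁.Nonempty ∧ S₂.Nonempty ∧ Disjoint S₁ S₂ ∧
      ∑ p ∈ S₁, W p.1 p.2 = ∑ p ∈ S₂, W p.1 p.2 ∧ 0 < ∑ p ∈ S₁, W p.1 p.2 := by
  have hvi : v ∉ V i := fun h => hij ((hVpart v).unique h hv)
  have heq : ∑ u' ∈ U i, ∑ v' ∈ (V i)ᶜ, W u' v' = ∑ u' ∈ (U i)ᶜ, ∑ v' ∈ V i, W u' v' := by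
    have h := hbal i
    have h1 : ∑ u' ∈ U i, ∑ v', W u' v'
        = ∑ u' ∈ U i, ∑ v' ∈ V i, W u' v' + ∑ u' ∈ U i, ∑ v' ∈ (V i)ᶜ, W u' v' := by
      rw [← Finset.sum_add_distrib]
      exact Finset.sum_congr rfl fun x _ => (Finset.sum_add_sum_compl (V i) _).symm
    have h2 : ∑ v' ∈ V i, ∑ u', W u' v'
        = ∑ u' ∈ U i, ∑ v' ∈ V i, W u' v' + ∑ u' ∈ (U i)ᶜ, ∑ v' ∈ V i, W u' v' := by
      rw [Finset.sum_comm, Finset.sum_add_sum_compl (U i)]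
    linarith
  have hp : 0 < ∑ u' ∈ U i, ∑ v' ∈ (V i)ᶜ, W u' v' := by
    have h1 : W u v ≤ ∑ v' ∈ (V i)ᶜ, W u v' :=
      Finset.single_le_sum (f := fun v' => W u v') (fun x _ => hW u x) (Finset.mem_compl.2 hvi)
    have h2 : ∑ v' ∈ (V i)ᶜ, W u v' ≤ ∑ u' ∈ U i, ∑ v' ∈ (V i)ᶜ, W u' v' :=
      Finset.single_le_sum (f := fun u' => ∑ v' ∈ (V i)ᶜ, W u' v')
        (fun x _ => Finset.sum_nonneg fun y _ => hW x y) hu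
    linarith
  have e1 : ∑ p ∈ U i ×ˢ (V i)ᶜ, W p.1 p.2 = ∑ u' ∈ U i, ∑ v' ∈ (V i)ᶜ, W u' v' :=
    Finset.sum_product _ _ _
  have e2 : ∑ p ∈ (U i)ᶜ ×ˢ V i, W p.1 p.2 = ∑ u' ∈ (U i)ᶜ, ∑ v' ∈ V i, W u' v' :=
    Finset.sum_product _ _ _
  refine ⟨heq, hp, U i ×ˢ (V i)ᶜ, (U i)ᶜ ×ˢ V i, ?_, ?_, ?_, ?_, ?_⟩
  · exact ⟨(u, v), Finset.mem_product.2 ⟨hu, Finset.mem_compl.2 hvi⟩⟩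
  · rw [Finset.nonempty_iff_ne_empty]
    intro h
    rw [h, Finset.sum_empty] at e2
    linarith
  · exact Finset.disjoint_product.2 (Or.inl disjoint_compl_right)
  · rw [e1, e2, heq]
  · rw [e1]
    exact hp
end

section
/- Let D be an n×n real matrix, not identically zero, all of whose row sums and column sums are zero. Then there exist an integer k ≥ 2, distinct indices u₁,…,u_k and distinct indices v₁,…,v_k in {1,…,n} such that D_{u_i v_i} > 0 and D_{u_i v_{i+1}} < 0 for all i = 1,…,k (with v_{k+1} := v₁). -/
open Finset

/-- a nonzero real matrix `D` with all row and column sums zero admits an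
alternating cycle: distinct `u₁,…,u_k` and distinct `v₁,…,v_k` (`k ≥ 2`) with
`D_{u_i v_i} > 0` and `D_{u_i v_{i+1}} < 0` (indices mod `k`). -/
theorem statement13 (n : ℕ) (D : Matrix (Fin n) (Fin n) ℝ) (hD : D ≠ 0)
    (hrow : ∀ u, ∑ v, D u v = 0) (hcol : ∀ v, ∑ u, D u v = 0) :
    ∃ (k : ℕ) (hk : 2 ≤ k) (u v : Fin k → Fin n),
      Function.Injective u ∧ Function.Injective v ∧
      ∀ i : Fin k,
        0 < D (u i) (v i) ∧
        D (u i) (v ⟨(i.1 + 1) % k, Nat.mod_lt _ (by omega)⟩) < 0 := by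
  have neg_of_pos : ∀ F : Fin n → ℝ, ∑ i, F i = 0 → (∃ i, 0 < F i) → ∃ j, F j < 0 := by
    intro F hF ⟨i, hi⟩
    by_contra! h
    have := (Finset.sum_eq_zero_iff_of_nonneg (fun j _ => h j)).1 hF i (Finset.mem_univ i)
    linarith
  have pos_of_neg : ∀ F : Fin n → ℝ, ∑ i, F i = 0 → (∃ i, F i < 0) → ∃ j, 0 < F j := by
    intro F hF ⟨i, hi⟩
    obtain ⟨j, hj⟩ := neg_of_pos (fun i => - F i) (by simp [hF]) ⟨i, by simpa using hi⟩
    exact ⟨j, by simpa using hj⟩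
  have h0 : ∃ v, ∃ u, 0 < D u v := by
    by_contra! h
    apply hD
    ext u v
    by_contra hne
    have hlt : D u v < 0 := lt_of_le_of_ne (h v u) hne
    obtain ⟨w, hw⟩ := pos_of_neg (fun u => D u v) (hcol v) ⟨u, hlt⟩
    exact absurd hw (not_lt.2 (h v w))
  obtain ⟨v0, hv0⟩ := h0
  have hf : ∀ v, ∃ u, (∃ u, 0 < D u v) → 0 < D u v := by
    intro v
    by_cases h : ∃ u, 0 < D u v
    · exact ⟨h.choose, fun _ => h.choose_spec⟩
    · exact ⟨v0, fun h' => absurd h' h⟩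
  have hg : ∀ u, ∃ w, (∃ v, 0 < D u v) → D u w < 0 := by
    intro u
    by_cases h : ∃ v, 0 < D u v
    · obtain ⟨w, hw⟩ := neg_of_pos (D u) (hrow u) h
      exact ⟨w, fun _ => hw⟩
    · exact ⟨v0, fun h' => absurd h' h⟩
  choose f hf using hf
  choose g hg using hg
  let h : Fin n → Fin n := fun v => g (f v)
  have hneg : ∀ v, (∃ u, 0 < D u v) → D (f v) (h v) < 0 := fun v hv => hg _ ⟨v, hf v hv⟩
  have hP : ∀ m, ∃ u, 0 < D u (h^[m] v0) := by
    intro m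
    induction m with
    | zero => exact hv0
    | succ m ih =>
      rw [Function.iterate_succ_apply']
      exact pos_of_neg (fun u => D u _) (hcol _) ⟨_, hneg _ ih⟩
  obtain ⟨a, b, hab, he⟩ : ∃ a b : ℕ, a < b ∧ h^[a] v0 = h^[b] v0 := by
    obtain ⟨a, b, hne, he⟩ := Finite.exists_ne_map_eq_of_infinite (fun m : ℕ => h^[m] v0)
    rcases lt_or_gt_of_ne hne with hl | hl
    · exact ⟨a, b, hl, he⟩
    · exact ⟨b, a, hl, he.symm⟩
  obtain ⟨x, hx⟩ : ∃ x, x = h^[a] v0 := ⟨_, rfl⟩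
  have hPx : ∀ m, ∃ u, 0 < D u (h^[m] x) := by
    intro m
    rw [hx, ← Function.iterate_add_apply]
    exact hP _
  have hper : Function.IsPeriodicPt h (b - a) x := by
    change h^[b - a] x = x
    rw [hx, ← Function.iterate_add_apply, Nat.sub_add_cancel hab.le, he]
  have hkpos : 0 < Function.minimalPeriod h x := hper.minimalPeriod_pos (by omega)
  have hk1 : Function.minimalPeriod h x ≠ 1 := by
    intro h1
    have hfix : h x = x := Function.minimalPeriod_eq_one_iff_isFixedPt.1 h1
    have p := hf x (hPx 0)
    have q := hneg x (hPx 0)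
    rw [hfix] at q
    linarith
  have hinj : ∀ i j, i < Function.minimalPeriod h x → j < Function.minimalPeriod h x →
      h^[i] x = h^[j] x → i = j := fun i j hi hj e =>
    Function.iterate_injOn_Iio_minimalPeriod hi hj e
  refine ⟨Function.minimalPeriod h x, by omega, fun i => f (h^[i.1] x), fun i => h^[i.1] x,
    ?_, ?_, ?_⟩
  · intro i j e
    have e1 : h^[i.1 + 1] x = h^[j.1 + 1] x := by
      rw [Function.iterate_succ_apply', Function.iterate_succ_apply']
      exact congrArg g e
    rw [← Function.iterate_mod_minimalPeriod_eq (n := i.1 + 1),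
      ← Function.iterate_mod_minimalPeriod_eq (n := j.1 + 1)] at e1
    have e2 := hinj _ _ (Nat.mod_lt _ hkpos) (Nat.mod_lt _ hkpos) e1
    have e3 : i.1 ≡ j.1 [MOD Function.minimalPeriod h x] := Nat.ModEq.add_right_cancel' 1 e2
    exact Fin.ext (Nat.ModEq.eq_of_lt_of_lt e3 i.2 j.2)
  · intro i j e
    exact Fin.ext (hinj _ _ i.2 j.2 e)
  · intro i
    refine ⟨hf _ (hPx _), ?_⟩
    have q := hneg _ (hPx i.1)
    rw [← Function.iterate_succ_apply' h,
      ← Function.iterate_mod_minimalPeriod_eq (n := i.1.succ)] at q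
    exact q
end

section
/- Every n×n real matrix all of whose row sums and column sums are zero can be written as a finite real linear combination of cycle matrices. -/
open Finset

/-- The cycle matrix associated with distinct rows `u₁,…,u_k` and distinct columns
`v₁,…,v_k`: it has `+1` at `(u_i, v_i)` and `−1` at `(u_i, v_{i+1})` (indices mod `k`),
and `0` elsewhere. -/
def cycleMatrix {n k : ℕ} (hk : 0 < k) (u v : Fin k → Fin n) :
    Matrix (Fin n) (Fin n) ℝ := fun a b =>
  ∑ i : Fin k,
    ((if a = u i ∧ b = v i then (1 : ℝ) else 0) -
      (if a = u i ∧ b = v ⟨(i.1 + 1) % k, Nat.mod_lt _ hk⟩ then (1 : ℝ) else 0))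

/-- every real matrix with all row and column sums zero is a finite real
linear combination of cycle matrices. -/
theorem statement14 (n : ℕ) (D : Matrix (Fin n) (Fin n) ℝ)
    (hrow : ∀ u, ∑ v, D u v = 0) (hcol : ∀ v, ∑ u, D u v = 0) :
    ∃ (m : ℕ) (c : Fin m → ℝ) (kk : Fin m → ℕ) (hkk : ∀ j, 2 ≤ kk j)
      (u : (j : Fin m) → Fin (kk j) → Fin n) (v : (j : Fin m) → Fin (kk j) → Fin n),
      (∀ j, Function.Injective (u j)) ∧ (∀ j, Function.Injective (v j)) ∧
      D = ∑ j : Fin m,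
        c j • cycleMatrix (Nat.lt_of_lt_of_le Nat.zero_lt_two (hkk j)) (u j) (v j) := by
  rcases n with _ | N
  · exact ⟨0, fun _ => 0, fun _ => 2, fun _ => le_rfl, fun j => j.elim0, fun j => j.elim0,
      fun j => j.elim0, fun j => j.elim0, by ext a; exact a.elim0⟩
  · refine ⟨N * N, fun j => D (finProdFinEquiv.symm j).1.succ (finProdFinEquiv.symm j).2.succ,
      fun _ => 2, fun _ => le_rfl, fun j => ![(finProdFinEquiv.symm j).1.succ, 0],
      fun j => ![(finProdFinEquiv.symm j).2.succ, 0], ?_, ?_, ?_⟩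
    · intro j x y
      fin_cases x <;> fin_cases y <;> simp [Fin.succ_ne_zero, (Fin.succ_ne_zero _).symm]
    · intro j x y
      fin_cases x <;> fin_cases y <;> simp [Fin.succ_ne_zero, (Fin.succ_ne_zero _).symm]
    · rw [Equiv.sum_comp finProdFinEquiv.symm (fun p : Fin N × Fin N => D p.1.succ p.2.succ •
        cycleMatrix (k := 2) (Nat.lt_of_lt_of_le Nat.zero_lt_two le_rfl) ![p.1.succ, 0]
          ![p.2.succ, 0]), Fintype.sum_prod_type]
      have hr : ∀ a, ∑ j : Fin N, D a j.succ = - D a 0 := fun a => by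
        have h := hrow a
        rw [Fin.sum_univ_succ] at h
        linarith
      have hc : ∀ b, ∑ i : Fin N, D i.succ b = - D 0 b := fun b => by
        have h := hcol b
        rw [Fin.sum_univ_succ] at h
        linarith
      ext a b
      simp only [Matrix.sum_apply, Matrix.smul_apply, cycleMatrix, Fin.sum_univ_two, smul_eq_mul]
      refine Fin.cases ?_ (fun a => ?_) a <;> refine Fin.cases ?_ (fun b => ?_) b <;>
        simp [Fin.succ_ne_zero, (Fin.succ_ne_zero _).symm, hr, hc, ite_and, Finset.sum_ite_eq]
end
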